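/- Let K be a field and R = K[u,v,x,y]/(uv - f(x,y)) where f = f_0 ⋯ f_n is a product of polynomials f_i = y^{k_i} ± x^{l_i} with (k_i, ±l_i) pairwise distinct and at least one of k_i, l_i equal to 1 for each i. Then R is a normal integral domain. -/

import Mathlib

open MvPolynomial

namespace CAnAux

lemma core {R A : Type*} [CommRing R] [CommRing A] [IsDomain R] [IsDomain A]
    [IsIntegrallyClosed A] (j : A →+* R) (hj : Function.Injective j) (s : A) (hs : s ≠ 0)
    (h : ∀ r, ∃ (n : ℕ) (p : A), j s ^ n * r = j p)
    (L : Type*) [Field L] [Algebra R L] [IsFractionRing R L] (g : L) (hg : IsIntegral R g) :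
    ∃ (n : ℕ) (a : R), algebraMap R L (j s) ^ n * g = algebraMap R L a := by
  have hjs : j s ≠ 0 := by
    intro h0; exact hs (hj (by simpa using h0))
  let T := Localization.Away (j s)
  have hle : Submonoid.powers (j s) ≤ nonZeroDivisors R :=
    powers_le_nonZeroDivisors_of_noZeroDivisors hjs
  have : IsDomain T := IsLocalization.isDomain_localization hle
  have hRT : Function.Injective (algebraMap R T) := IsLocalization.injective T hle
  let : Algebra A T := ((algebraMap R T).comp j).toAlgebra
  have hAT : ∀ a, algebraMap A T a = algebraMap R T (j a) := fun a => rfl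
  have : IsLocalization.Away s T := by
    refine IsLocalization.Away.mk s ?_ ?_ ?_
    · rw [hAT]; exact IsLocalization.Away.algebraMap_isUnit (j s)
    · intro z
      obtain ⟨n, r, hr⟩ := IsLocalization.Away.surj (j s) z
      obtain ⟨m, p, hp⟩ := h r
      refine ⟨n + m, p, ?_⟩
      rw [hAT, hAT, ← hp, pow_add, ← mul_assoc, hr, map_mul, map_pow, mul_comm]
    · intro a b hab
      rw [hAT, hAT] at hab
      exact ⟨0, by rw [hj (hRT hab)]⟩
  have : IsIntegrallyClosed T :=
    isIntegrallyClosed_of_isLocalization T (Submonoid.powers s)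
      (powers_le_nonZeroDivisors_of_noZeroDivisors hs)
  have hu : IsUnit (algebraMap R L (j s)) := by
    rw [isUnit_iff_ne_zero]
    intro h0
    exact hjs (IsFractionRing.injective R L (by simpa using h0))
  let : Algebra T L := (IsLocalization.Away.lift (S := T) (j s) hu).toAlgebra
  have : IsScalarTower R T L := IsScalarTower.of_algebraMap_eq (fun a =>
    (IsLocalization.Away.lift_eq (S := T) (j s) hu a).symm)
  have : IsFractionRing T L :=
    IsFractionRing.isFractionRing_of_isDomain_of_isLocalization (Submonoid.powers (j s)) T L
  have hgT : IsIntegral T g := hg.tower_top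
  obtain ⟨y, hy⟩ := (isIntegrallyClosed_iff L).1 ‹IsIntegrallyClosed T› hgT
  obtain ⟨n, r, hr⟩ := IsLocalization.Away.surj (j s) y
  refine ⟨n, r, ?_⟩
  rw [← hy, IsScalarTower.algebraMap_apply R T L r, ← hr, map_mul, map_pow,
    ← IsScalarTower.algebraMap_apply, mul_comm]

lemma glue {R : Type*} [CommRing R] [IsDomain R] (u v : R) (hu : u ≠ 0) (hv : v ≠ 0)
    (hreg : ∀ r, u ∣ v * r → u ∣ r)
    (h1 : ∀ g : FractionRing R, IsIntegral R g →
      ∃ (n : ℕ) (a : R), algebraMap R (FractionRing R) u ^ n * g = algebraMap R _ a)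
    (h2 : ∀ g : FractionRing R, IsIntegral R g →
      ∃ (n : ℕ) (a : R), algebraMap R (FractionRing R) v ^ n * g = algebraMap R _ a) :
    IsIntegrallyClosed R := by
  have hreg1 : ∀ m r, u ∣ v ^ m * r → u ∣ r := by
    intro m
    induction m with
    | zero => intro r h; simpa using h
    | succ m ih => intro r h; exact ih r (hreg _ (by rwa [pow_succ', mul_assoc] at h))
  have hreg2 : ∀ n m r, u ^ n ∣ v ^ m * r → u ^ n ∣ r := by
    intro n m
    induction n with
    | zero => intro r h; simp
    | succ n ih =>
      intro r h
      obtain ⟨r', rfl⟩ := ih r ((pow_dvd_pow u n.le_succ).trans h)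
      rw [pow_succ, mul_left_comm] at h
      rw [pow_succ]
      exact mul_dvd_mul_left _ (hreg1 m _ (by
        exact (mul_dvd_mul_iff_left (pow_ne_zero n hu)).1 h))
  rw [isIntegrallyClosed_iff (FractionRing R)]
  intro g hg
  obtain ⟨n, a, ha⟩ := h1 g hg
  obtain ⟨m, b, hb⟩ := h2 g hg
  have inj := IsFractionRing.injective R (FractionRing R)
  have key : v ^ m * a = u ^ n * b := by
    apply inj
    rw [map_mul, map_mul, ← ha, ← hb, map_pow, map_pow]; ring
  obtain ⟨c, rfl⟩ := hreg2 n m a ⟨b, key⟩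
  refine ⟨c, ?_⟩
  rw [map_mul, map_pow] at ha
  have : algebraMap R (FractionRing R) u ^ n ≠ 0 :=
    pow_ne_zero _ (fun h0 => hu (inj (by simpa using h0)))
  exact (mul_left_cancel₀ this ha).symm

section
variable {K : Type*} [Field K] (f : MvPolynomial (Fin 2) K)

noncomputable def F : MvPolynomial (Fin 4) K := aeval ![X 2, X 3] f

noncomputable def I : Ideal (MvPolynomial (Fin 4) K) := Ideal.span {X 0 * X 1 - F f}

noncomputable abbrev Q : Type _ := MvPolynomial (Fin 4) K ⧸ I f

noncomputable def q : MvPolynomial (Fin 4) K →ₐ[K] Q f := Ideal.Quotient.mkₐ K (I f)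

def Good (a b : Fin 4) : Prop := (a = 0 ∧ b = 1) ∨ (a = 1 ∧ b = 0)

lemma q_surj : Function.Surjective (q f) := Ideal.Quotient.mk_surjective

lemma q_zero (p) : q f p = 0 ↔ X 0 * X 1 - F f ∣ p := by
  rw [← Ideal.mem_span_singleton]
  exact Ideal.Quotient.eq_zero_iff_mem

variable {a b : Fin 4}

lemma mul_ab (hab : Good a b) : (X a * X b : MvPolynomial (Fin 4) K) = X 0 * X 1 := by
  rcases hab with ⟨rfl, rfl⟩ | ⟨rfl, rfl⟩
  · rfl
  · exact mul_comm _ _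

lemma rel (hab : Good a b) : q f (X a) * q f (X b) = q f (F f) := by
  rw [← sub_eq_zero, ← map_mul, ← map_sub, q_zero, mul_ab hab]

/-- kill the variable `a` -/
noncomputable def kill (K : Type*) [Field K] (a : Fin 4) :
    MvPolynomial (Fin 4) K →ₐ[K] MvPolynomial (Fin 4) K :=
  aeval (fun i => if i = a then 0 else X i)

lemma kill_dvd (a : Fin 4) (p : MvPolynomial (Fin 4) K) : X a ∣ p - kill K a p := by
  induction p using MvPolynomial.induction_on with
  | C c => simp [kill]
  | add p r hp hr =>
    rw [map_add, add_sub_add_comm]; exact dvd_add hp hr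
  | mul_X p i hp =>
    by_cases h : i = a
    · subst h; simp [kill]
    · have : kill K a (X i) = X i := by simp [kill, h]
      rw [map_mul, this, ← sub_mul]; exact hp.mul_right _

lemma kill_F (hab : Good a b) : kill K a (F f) = F f := by
  have : (kill K a).comp (aeval ![X 2, X 3]) = (aeval ![X 2, X 3] : MvPolynomial (Fin 2) K →ₐ[K] _) := by
    apply MvPolynomial.algHom_ext
    intro i
    rcases hab with ⟨rfl, rfl⟩ | ⟨rfl, rfl⟩ <;> fin_cases i <;> simp [kill]
  exact DFunLike.congr_fun this f

lemma F_ne (hf : f ≠ 0) : F f ≠ 0 := by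
  intro h
  apply hf
  have : (aeval ![0, 0, X 0, X 1]).comp (aeval ![X 2, X 3]) = AlgHom.id K (MvPolynomial (Fin 2) K) := by
    apply MvPolynomial.algHom_ext
    intro i
    fin_cases i <;> simp
  have h2 := DFunLike.congr_fun this f
  have h3 : aeval ![X 2, X 3] f = (0 : MvPolynomial (Fin 4) K) := h
  rw [AlgHom.comp_apply, h3, map_zero] at h2
  exact h2.symm

lemma not_dvd (hab : Good a b) (hf : f ≠ 0) : ¬ (X a ∣ F f) := by
  rintro ⟨c, hc⟩
  have := congrArg (kill K a) hc
  rw [kill_F f hab, map_mul] at this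
  exact F_ne f hf (by rw [this]; simp [kill])

lemma nzd (hab : Good a b) (hf : f ≠ 0) (r : Q f) (h : q f (X a) * r = 0) : r = 0 := by
  obtain ⟨p, rfl⟩ := q_surj f r
  rw [← map_mul, q_zero, ← mul_ab hab] at h
  obtain ⟨t, ht⟩ := h
  have h1 : X a ∣ F f * t := ⟨X b * t - p, by linear_combination ht⟩
  obtain ⟨t', rfl⟩ := (X_prime.dvd_or_dvd h1).resolve_left (not_dvd f hab hf)
  rw [q_zero, ← mul_ab hab]
  refine ⟨t', ?_⟩
  apply mul_left_cancel₀ (X_ne_zero (R := K) a)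
  rw [ht]; ring

lemma reg (hf : f ≠ 0) (r : Q f) (h : q f (X 0) ∣ q f (X 1) * r) : q f (X 0) ∣ r := by
  obtain ⟨p, rfl⟩ := q_surj f r
  obtain ⟨s, hs⟩ := h
  obtain ⟨s, rfl⟩ := q_surj f s
  rw [← sub_eq_zero, ← map_mul, ← map_mul, ← map_sub, q_zero] at hs
  obtain ⟨t, ht⟩ := hs
  have h0 : Good 0 1 := Or.inl ⟨rfl, rfl⟩
  have h1 : Good 1 0 := Or.inr ⟨rfl, rfl⟩
  have hk := congrArg (kill K 0) ht
  have e0 : kill K 0 (X 0) = 0 := by simp [kill]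
  have e1 : kill K 0 (X 1) = X 1 := by simp [kill]
  simp only [map_sub, map_mul, kill_F f h0, e0, e1, zero_mul, sub_zero, zero_sub] at hk
  obtain ⟨t', ht'⟩ := (X_prime.dvd_or_dvd (⟨- kill K 0 p, by linear_combination hk⟩ :
    X 1 ∣ F f * kill K 0 t)).resolve_left (not_dvd f h1 hf)
  have hp : kill K 0 p = - F f * t' := by
    apply mul_left_cancel₀ (X_ne_zero (R := K) (1 : Fin 4))
    rw [hk, ht']; ring
  obtain ⟨c, hc⟩ := kill_dvd 0 p
  refine ⟨q f (c - X 1 * t'), ?_⟩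
  rw [← sub_eq_zero, ← map_mul, ← map_sub, q_zero]
  exact ⟨t', by linear_combination hc + hp⟩

noncomputable def j (a : Fin 4) : MvPolynomial (Fin 3) K →ₐ[K] Q f :=
  aeval ![q f (X a), q f (X 2), q f (X 3)]

lemma j_F (a : Fin 4) : j f a (aeval ![X 1, X 2] f) = q f (F f) := by
  have : (j f a).comp (aeval ![X 1, X 2]) = (q f).comp (aeval ![X 2, X 3]) := by
    apply MvPolynomial.algHom_ext
    intro i
    fin_cases i <;> simp [j]
  exact DFunLike.congr_fun this f

lemma j_pow (hab : Good a b) (r : Q f) : ∃ (n : ℕ) (p : MvPolynomial (Fin 3) K), j f a (X 0) ^ n * r = j f a p := by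
  have e0 : j f a (X 0) = q f (X a) := by simp [j]
  have e1 : j f a (X 1) = q f (X 2) := by simp [j]
  have e2 : j f a (X 2) = q f (X 3) := by simp [j]
  obtain ⟨r, rfl⟩ := q_surj f r
  induction r using MvPolynomial.induction_on with
  | C c => exact ⟨0, C c, by simp [← MvPolynomial.algebraMap_eq]⟩
  | add p r hp hr =>
    obtain ⟨n, p', hp⟩ := hp
    obtain ⟨m, r', hr⟩ := hr
    refine ⟨n + m, X 0 ^ m * p' + X 0 ^ n * r', ?_⟩
    simp only [map_add, map_mul, map_pow, ← hp, ← hr]; ring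
  | mul_X p i hp =>
    obtain ⟨n, p', hp⟩ := hp
    have hi : i = a ∨ i = b ∨ i = 2 ∨ i = 3 := by
      rcases hab with ⟨rfl, rfl⟩ | ⟨rfl, rfl⟩ <;> fin_cases i <;> simp
    rcases hi with rfl | rfl | rfl | rfl
    · exact ⟨n, p' * X 0, by rw [map_mul, map_mul, ← hp, e0]; ring⟩
    · refine ⟨n + 1, p' * aeval ![X 1, X 2] f, ?_⟩
      rw [map_mul, map_mul, ← hp, j_F, ← rel f hab, e0]; ring
    · exact ⟨n, p' * X 1, by rw [map_mul, map_mul, ← hp, e1]; ring⟩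
    · exact ⟨n, p' * X 2, by rw [map_mul, map_mul, ← hp, e2]; ring⟩

lemma exists_psi (hab : Good a b) : ∃ ψ : Q f →ₐ[K] FractionRing (MvPolynomial (Fin 3) K),
    ∀ p, ψ (j f a p) = algebraMap _ _ p := by
  let L := FractionRing (MvPolynomial (Fin 3) K)
  let ι : MvPolynomial (Fin 3) K →ₐ[K] L := IsScalarTower.toAlgHom K _ _
  let s : L := ι (X 0)
  have hs : s ≠ 0 := fun h => X_ne_zero (R := K) (0 : Fin 3)
    (IsFractionRing.injective (MvPolynomial (Fin 3) K) L (h.trans (map_zero _).symm))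
  let w : Fin 4 → L := fun i => if i = a then s else if i = b then ι (aeval ![X 1, X 2] f) / s
    else if i = 2 then ι (X 1) else ι (X 2)
  have hne : a ≠ b ∧ 2 ≠ a ∧ 2 ≠ b ∧ 3 ≠ a ∧ 3 ≠ b := by
    rcases hab with ⟨rfl, rfl⟩ | ⟨rfl, rfl⟩ <;> decide
  obtain ⟨n1, n2, n3, n4, n5⟩ := hne
  have wa : w a = s := by simp [w]
  have wb : w b = ι (aeval ![X 1, X 2] f) / s := by simp [w, n1.symm]
  have w2 : w 2 = ι (X 1) := by simp [w, n2, n3]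
  have w3 : w 3 = ι (X 2) := by simp [w, n4, n5]
  have hF : aeval w (F f) = ι (aeval ![X 1, X 2] f) := by
    have : (aeval w).comp (aeval ![X 2, X 3]) =
        ι.comp (aeval ![X 1, X 2] : MvPolynomial (Fin 2) K →ₐ[K] _) := by
      apply MvPolynomial.algHom_ext
      intro i
      fin_cases i <;> simp [w2, w3]
    exact DFunLike.congr_fun this f
  have hker : ∀ p ∈ I f, aeval w p = 0 := by
    intro p hp
    obtain ⟨c, rfl⟩ := Ideal.mem_span_singleton.1 hp
    rw [map_mul, map_sub, ← mul_ab hab, map_mul, hF, aeval_X, aeval_X, wa, wb,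
      mul_div_cancel₀ _ hs, sub_self, zero_mul]
  refine ⟨Ideal.Quotient.liftₐ (I f) (aeval w) hker, ?_⟩
  have hq : ∀ p, Ideal.Quotient.liftₐ (I f) (aeval w) hker (q f p) = aeval w p := fun p => rfl
  have : (Ideal.Quotient.liftₐ (I f) (aeval w) hker).comp (j f a) = ι := by
    apply MvPolynomial.algHom_ext
    intro i
    rw [AlgHom.comp_apply]
    fin_cases i
    · have : j f a (X 0) = q f (X a) := by simp [j]
      simpa [this, hq] using wa
    · have : j f a (X 1) = q f (X 2) := by simp [j]
      simpa [this, hq] using w2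
    · have : j f a (X 2) = q f (X 3) := by simp [j]
      simpa [this, hq] using w3
  exact fun p => DFunLike.congr_fun this p

lemma j_inj (hab : Good a b) : Function.Injective (j f a) := by
  obtain ⟨ψ, hψ⟩ := exists_psi f hab
  intro p r h
  apply IsFractionRing.injective (MvPolynomial (Fin 3) K) (FractionRing (MvPolynomial (Fin 3) K))
  rw [← hψ, ← hψ, h]

lemma dom (hf : f ≠ 0) : IsDomain (Q f) := by
  have hab : Good 0 1 := Or.inl ⟨rfl, rfl⟩
  obtain ⟨ψ, hψ⟩ := exists_psi f hab
  have : Function.Injective ψ := by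
    rw [injective_iff_map_eq_zero]
    intro r hr
    obtain ⟨n, p, hp⟩ := j_pow f hab r
    have h1 := congrArg ψ hp
    rw [map_mul, hr, mul_zero, hψ] at h1
    have h2 : p = 0 := IsFractionRing.injective (MvPolynomial (Fin 3) K)
      (FractionRing (MvPolynomial (Fin 3) K)) (by simpa using h1.symm)
    have e0 : j f 0 (X 0) = q f (X 0) := by simp [j]
    rw [h2, map_zero, e0] at hp
    clear h1 h2
    induction n with
    | zero => simpa using hp
    | succ n ih => exact ih (nzd f hab hf _ (by rw [← hp]; ring))
  exact this.isDomain ψ.toRingHom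

lemma normal_of_ne (hf : f ≠ 0) : IsDomain (Q f) ∧ IsIntegrallyClosed (Q f) := by
  have := dom f hf
  refine ⟨this, ?_⟩
  have h0 : Good 0 1 := Or.inl ⟨rfl, rfl⟩
  have h1 : Good 1 0 := Or.inr ⟨rfl, rfl⟩
  have e : ∀ a, j f a (X 0) = q f (X a) := fun a => by simp [j]
  have ne : ∀ {a b}, Good a b → q f (X a) ≠ 0 := by
    intro a b hab h
    rw [← e, ← map_zero (j f a)] at h
    exact X_ne_zero _ (j_inj f hab h)
  refine glue (q f (X 0)) (q f (X 1)) (ne h0) (ne h1) (reg f hf) ?_ ?_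
  · intro g hg
    rw [← e]
    exact core (j f 0).toRingHom (j_inj f h0) (X 0) (X_ne_zero _) (j_pow f h0) _ g hg
  · intro g hg
    rw [← e]
    exact core (j f 1).toRingHom (j_inj f h1) (X 0) (X_ne_zero _) (j_pow f h1) _ g hg

end

lemma factor_ne {K : Type*} [Field K] (k l : ℕ) (ε : K) (hε : ε = 1 ∨ ε = -1)
    (hkl : k = 1 ∨ l = 1) :
    (X 1 ^ k + C ε * X 0 ^ l : MvPolynomial (Fin 2) K) ≠ 0 := by
  have hε0 : ε ≠ 0 := by rcases hε with rfl | rfl <;> simp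
  intro h
  rcases hkl with rfl | rfl
  · have := congrArg (aeval ![1, (Polynomial.X : Polynomial K)]) h
    have := congrArg (fun p => Polynomial.coeff p 1) this
    simp [← MvPolynomial.algebraMap_eq, Polynomial.algebraMap_eq, Polynomial.coeff_C] at this
  · have := congrArg (aeval ![(Polynomial.X : Polynomial K), 1]) h
    have := congrArg (fun p => Polynomial.coeff p 1) this
    simp [← MvPolynomial.algebraMap_eq, Polynomial.algebraMap_eq, Polynomial.coeff_one, hε0] at this

end CAnAux

/-- The `cAₙ` singularity `R_f = K[u,v,x,y]/(uv - f(x,y))`, where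
`f = f_0 ⋯ f_n` with `f_i = y^{k_i} + ε_i x^{l_i}` (`ε_i = ±1`), the data
`(k_i, ε_i l_i)` pairwise distinct and at least one of `k_i, l_i` equal to `1`,
is a normal integral domain. Variables `0,1,2,3` stand for `u,v,x,y`. -/
theorem cAn_singularity_normal_domain (K : Type*) [Field K] (n : ℕ)
    (k l : Fin (n + 1) → ℕ) (ε : Fin (n + 1) → K)
    (hε : ∀ i, ε i = 1 ∨ ε i = -1)
    (hkl : ∀ i, k i = 1 ∨ l i = 1)
    (hdist : ∀ i j, i ≠ j → (k i, l i, ε i) ≠ (k j, l j, ε j)) :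
    IsDomain (MvPolynomial (Fin 4) K ⧸ Ideal.span
      {(X 0 * X 1 - ∏ i, (X 3 ^ k i + C (ε i) * X 2 ^ l i) : MvPolynomial (Fin 4) K)}) ∧
    IsIntegrallyClosed (MvPolynomial (Fin 4) K ⧸ Ideal.span
      {(X 0 * X 1 - ∏ i, (X 3 ^ k i + C (ε i) * X 2 ^ l i) : MvPolynomial (Fin 4) K)}) := by
  have hf : (∏ i, (X 1 ^ k i + C (ε i) * X 0 ^ l i) : MvPolynomial (Fin 2) K) ≠ 0 :=
    Finset.prod_ne_zero_iff.2 fun i _ => CAnAux.factor_ne _ _ _ (hε i) (hkl i)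
  have h := CAnAux.normal_of_ne _ hf
  have e : CAnAux.F (∏ i, (X 1 ^ k i + C (ε i) * X 0 ^ l i) : MvPolynomial (Fin 2) K) =
      ∏ i, (X 3 ^ k i + C (ε i) * X 2 ^ l i) := by
    simp [CAnAux.F, MvPolynomial.algebraMap_eq]
  unfold CAnAux.Q CAnAux.I at h
  rw [e] at h
  exact h
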